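/- Fix K ∈ ℕ and let f: P → ⊕_{k=0}^K S^k ℝ^m ⊗ Hom(V₁,V₂) be smooth and infinitesimally G₀-equivariant with respect to ⊕_k σ^(k). Set N^ω f := −2 Σ_{i=1}^m γ(εⁱ)(L_{ω^{-1}(eᵢ)}f) and let C₀ act pointwise (degreewise). Then for every h ∈ ℝ^{m*} ≅ g₁, the operator L_{ω^{-1}(h)} + γ(h) commutes with C₀ + N^ω on f: (L_{ω^{-1}(h)} + γ(h))((C₀ + N^ω)f) = (C₀ + N^ω)((L_{ω^{-1}(h)} + γ(h))f), where h is regarded as the element of g₁ with ξ-block h and γ acts pointwise. -/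

import Mathlib

open scoped BigOperators
noncomputable section
namespace ProjQuant

/-- `ℝ^m`. -/
abbrev Rm (m : ℕ) := Fin m → ℝ

/-- The index set for `(m+1) × (m+1)` matrices, split into blocks. -/
abbrev Idx (m : ℕ) := Sum (Fin m) Unit

/-- `gl(m,ℝ)`, realized as continuous linear endomorphisms of `ℝ^m`. -/
abbrev GLm (m : ℕ) := (Fin m → ℝ) →L[ℝ] (Fin m → ℝ)

/-- `ℝ^{m*}`. -/
abbrev Dualm (m : ℕ) := (Fin m → ℝ) →L[ℝ] ℝ

/-- The vector field `X^M` on `ℝ^m` attached to a matrix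
`M = [[A, v], [ξ, a]] ∈ sl(m+1,ℝ)`, namely `X^M(x) = -v - A x + a x + ξ(x) x`. -/
def projVF (m : ℕ) (M : Matrix (Idx m) (Idx m) ℝ) : Rm m → Rm m := fun x i =>
  -(M (Sum.inl i) (Sum.inr ())) - (∑ j, M (Sum.inl i) (Sum.inl j) * x j)
    + M (Sum.inr ()) (Sum.inr ()) * x i
    + (∑ j, M (Sum.inr ()) (Sum.inl j) * x j) * x i

/-- The Lie derivative of a `V`-valued function along a vector field `X`, with respect to a
representation `σ` of `gl(m,ℝ)` on `V`:  `(L_X f)(x) = Df(x)[X(x)] - σ(DX(x))(f(x))`. -/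
def lieD (m : ℕ) {V : Type} [NormedAddCommGroup V] [NormedSpace ℝ V]
    (σ : GLm m → V → V) (X : Rm m → Rm m) (f : Rm m → V) : Rm m → V :=
  fun x => fderiv ℝ f x (X x) - σ (fderiv ℝ X x) (f x)

/-- `σ` is a Lie algebra representation of `gl(m,ℝ)`. -/
def IsLieRep (m : ℕ) {V : Type} [NormedAddCommGroup V] [NormedSpace ℝ V]
    (σ : GLm m →ₗ[ℝ] (V →L[ℝ] V)) : Prop :=
  ∀ A B : GLm m, σ (A ∘L B - B ∘L A) = σ A ∘L σ B - σ B ∘L σ A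


/-- Iterated Lie derivative along the constant fields `X^{hᵢ} = -hᵢ`, outermost first. -/
def lieItC (m : ℕ) {V : Type} [NormedAddCommGroup V] [NormedSpace ℝ V]
    (σ : GLm m → V → V) : (k : ℕ) → (Fin k → Rm m) → (Rm m → V) → (Rm m → V)
  | 0, _, f => f
  | (k+1), v, f => lieD m σ (fun _ => -(v 0)) (lieItC m σ k (fun j => v j.succ) f)

section Symbols

variable (m : ℕ) (V₁ V₂ : Type)
  [NormedAddCommGroup V₁] [NormedSpace ℝ V₁] [NormedAddCommGroup V₂] [NormedSpace ℝ V₂]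

/-- The model for `S^k ℝ^m ⊗ Hom(V₁,V₂)`: multilinear maps on `k` copies of `ℝ^{m*}`
with values in `Hom(V₁,V₂)` (symbols of degree `k` are the symmetric ones). -/
abbrev Symb (k : ℕ) := ContinuousMultilinearMap ℝ (fun _ : Fin k => Dualm m) (V₁ →L[ℝ] V₂)

/-- The decomposable tensor `h₁ ⊗ ⋯ ⊗ h_k ⊗ A` in the model. -/
def pureT {k : ℕ} (v : Fin k → Rm m) (A : V₁ →L[ℝ] V₂) : Symb m V₁ V₂ k :=
  (ContinuousMultilinearMap.mkPiRing ℝ (Fin k) A).compContinuousLinearMap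
    (fun i => ContinuousLinearMap.apply ℝ ℝ (v i))

/-- The symmetric product `h₁ ∨ ⋯ ∨ h_k ⊗ A` in the model. -/
def symT {k : ℕ} (v : Fin k → Rm m) (A : V₁ →L[ℝ] V₂) : Symb m V₁ V₂ k :=
  ∑ ν : Equiv.Perm (Fin k), pureT m V₁ V₂ (v ∘ ν) A

/-- The subspace of the model corresponding to `S^k ℝ^m ⊗ Hom(V₁,V₂)` itself:
the span of the symmetric products. -/
def spanGen (k : ℕ) : Submodule ℝ (Symb m V₁ V₂ k) :=
  Submodule.span ℝ {T | ∃ (v : Fin k → Rm m) (A : V₁ →L[ℝ] V₂), T = symT m V₁ V₂ v A}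

/-- The rank-one endomorphism `u ⊗ h : x ↦ h(x) • u` of `ℝ^m`. -/
def rkOne (u : Rm m) (h : Dualm m) : GLm m := h.smulRight u

variable (σ₁ : GLm m →ₗ[ℝ] (V₁ →L[ℝ] V₁)) (σ₂ : GLm m →ₗ[ℝ] (V₂ →L[ℝ] V₂))

/-- The representation `σ^{(k)}` of `gl(m,ℝ)` on `S^k ℝ^m ⊗ Hom(V₁,V₂)`, determined by
`σ^{(k)}(B)(h₁∨⋯∨h_k ⊗ A) = Σᵢ h₁∨⋯∨(B hᵢ)∨⋯∨h_k ⊗ A + h₁∨⋯∨h_k ⊗ (σ₂(B)∘A - A∘σ₁(B))`. -/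
def sigmaS {k : ℕ} (B : GLm m) (T : Symb m V₁ V₂ k) : Symb m V₁ V₂ k :=
  (∑ t : Fin k, T.compContinuousLinearMap
    (fun s => if s = t then (ContinuousLinearMap.compL ℝ (Rm m) (Rm m) ℝ).flip B
      else ContinuousLinearMap.id ℝ (Dualm m)))
  + ((ContinuousLinearMap.compL ℝ V₁ V₂ V₂ (σ₂ B))
      - (ContinuousLinearMap.compL ℝ V₁ V₁ V₂).flip (σ₁ B)).compContinuousMultilinearMap T

/-- The `i`-th coordinate covector on `ℝ^m`. -/
def coordD (i : Fin m) : Dualm m := ContinuousLinearMap.proj i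

/-- The affine quantization (standard ordering): the full contraction of a degree-`k` symbol
with the `k`-th derivative, `Q_Aff(h₁∨⋯∨h_k ⊗ A)(f) = A(∂_{h₁} ⋯ ∂_{h_k} f)`. -/
def QAff {k : ℕ} (T : Rm m → Symb m V₁ V₂ k) (f : Rm m → V₁) : Rm m → V₂ :=
  fun x => (k.factorial : ℝ)⁻¹ • ∑ d : Fin k → Fin m,
    (T x (fun t => coordD m (d t))) (iteratedFDeriv ℝ k f x (fun t => Pi.single (d t) 1))

/-- The defining property of the map `γ(h) : S^{k+1} ℝ^m ⊗ Hom(V₁,V₂) → S^k ℝ^m ⊗ Hom(V₁,V₂)`,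
for `h ∈ ℝ^{m*} ≅ 𝔤₁`:
`γ(h)(h₁∨⋯∨h_{k+1} ⊗ A) = Σᵢ h₁∨⋯(omit hᵢ)⋯∨h_{k+1} ⊗ (A ∘ σ₁(hᵢ⊗h + h(hᵢ)·Id))`
`- Σᵢ Σ_{j<i} h₁∨⋯(omit hⱼ,hᵢ)⋯∨h_{k+1} ∨ (h(hⱼ)·hᵢ + h(hᵢ)·hⱼ) ⊗ A`. -/
def gammaProp {k : ℕ}
    (γ : Dualm m → (Symb m V₁ V₂ (k+1) →ₗ[ℝ] Symb m V₁ V₂ k)) : Prop :=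
  ∀ (h : Dualm m) (v : Fin (k+1) → Rm m) (A : V₁ →L[ℝ] V₂),
    γ h (symT m V₁ V₂ v A) =
      (∑ i : Fin (k+1), symT m V₁ V₂ (i.removeNth v)
        (A.comp (σ₁ (rkOne m (v i) h + h (v i) • ContinuousLinearMap.id ℝ (Rm m)))))
      - ∑ i : Fin (k+1), ∑ j : Fin k,
          if (i.succAbove j : ℕ) < (i : ℕ) then
            symT m V₁ V₂ (i.removeNth (Function.update v (i.succAbove j)
              (h (v (i.succAbove j)) • v i + h (v i) • v (i.succAbove j)))) A
          else 0

/-- The model for `⊕_{k=0}^K S^k ℝ^m ⊗ Hom(V₁,V₂)`. -/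
abbrev SymbT (K : ℕ) := ∀ k : Fin (K+1), Symb m V₁ V₂ (k : ℕ)

/-- The degree-wise representation `⊕_k σ^{(k)}` on `⊕_{k=0}^K S^k ℝ^m ⊗ Hom(V₁,V₂)`. -/
def sigmaT {K : ℕ} (B : GLm m) (T : SymbT m V₁ V₂ K) : SymbT m V₁ V₂ K :=
  fun k => sigmaS m V₁ V₂ σ₁ σ₂ B (T k)

/-- The extension of a family `γ` to `⊕_{k=0}^K S^k ℝ^m ⊗ Hom(V₁,V₂)` (lowering degree). -/
def gTot {K : ℕ} (γf : ∀ k : ℕ, Dualm m → (Symb m V₁ V₂ (k+1) →ₗ[ℝ] Symb m V₁ V₂ k))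
    (h : Dualm m) (T : SymbT m V₁ V₂ K) : SymbT m V₁ V₂ K :=
  fun k => if hk : (k : ℕ) + 1 < K + 1 then γf (k : ℕ) h (T ⟨(k : ℕ) + 1, hk⟩) else 0


/-- The action `ρ^{(k)}(a) = S^k a ⊗ (Φ ↦ ρ₂(a)∘Φ∘ρ₁(a)⁻¹)` of `GL(m,ℝ)` on
`S^k ℝ^m ⊗ Hom(V₁,V₂)`, in the model. -/
def rhoK {k : ℕ} (a : (Fin m → ℝ) ≃L[ℝ] (Fin m → ℝ)) (r₁ : V₁ ≃L[ℝ] V₁) (r₂ : V₂ ≃L[ℝ] V₂)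
    (T : Symb m V₁ V₂ k) : Symb m V₁ V₂ k :=
  ((ContinuousLinearMap.compL ℝ V₁ V₂ V₂ (r₂ : V₂ →L[ℝ] V₂)) ∘L
    ((ContinuousLinearMap.compL ℝ V₁ V₁ V₂).flip
      ((r₁.symm : V₁ →L[ℝ] V₁)))).compContinuousMultilinearMap
    (T.compContinuousLinearMap
      (fun _ => (ContinuousLinearMap.compL ℝ (Rm m) (Rm m) ℝ).flip
        (a : (Fin m → ℝ) →L[ℝ] (Fin m → ℝ))))

end Symbols

section Matrices

variable (m : ℕ)

/-- The element of `𝔤₁ ⊂ sl(m+1,ℝ)` with `ξ`-block the covector `h`. -/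
def hMat (h : Dualm m) : Matrix (Idx m) (Idx m) ℝ :=
  Matrix.fromBlocks 0 0 (Matrix.of fun _ j => h (Pi.single j 1)) 0

/-- The element of `𝔤₋₁ ⊂ sl(m+1,ℝ)` with `v`-block the vector `X`. -/
def XMat (X : Rm m) : Matrix (Idx m) (Idx m) ℝ :=
  Matrix.fromBlocks 0 (Matrix.of fun i _ => X i) 0 0

/-- The lift `B̃ ∈ 𝔤₀ ⊂ sl(m+1,ℝ)` of `B ∈ gl(m,ℝ)`, with `ψ(B̃) = B`. -/
def BTilde (B : GLm m) : Matrix (Idx m) (Idx m) ℝ :=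
  Matrix.fromBlocks
    (LinearMap.toMatrix' (B : (Fin m → ℝ) →ₗ[ℝ] (Fin m → ℝ))
      - ((LinearMap.trace ℝ (Rm m) (B : (Fin m → ℝ) →ₗ[ℝ] (Fin m → ℝ))) / ((m : ℝ) + 1)) • 1)
    0 0
    (Matrix.of fun _ _ => -(LinearMap.trace ℝ (Rm m) (B : (Fin m → ℝ) →ₗ[ℝ] (Fin m → ℝ))) / ((m : ℝ) + 1))

/-- The map `ψ : 𝔤₀ → gl(m,ℝ) : [[A,0],[0,a]] ↦ A - a·Id`. -/
def psiC (M : Matrix (Idx m) (Idx m) ℝ) : GLm m :=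
  LinearMap.toContinuousLinearMap
    ((Matrix.of fun i j => M (Sum.inl i) (Sum.inl j)).mulVecLin
      - M (Sum.inr ()) (Sum.inr ()) • LinearMap.id)

/-- The basis `(eᵢ)` of `𝔤₋₁`, corresponding to the standard basis of `ℝ^m`. -/
def eMat (i : Fin m) : Matrix (Idx m) (Idx m) ℝ := XMat m (Pi.single i 1)

/-- The covector `εⁱ = (1/(2(m+1))) δⁱ ∈ ℝ^{m*}`. -/
def epsD (i : Fin m) : Dualm m := (1 / (2 * ((m : ℝ) + 1))) • coordD m i

/-- The basis `(εⁱ)` of `𝔤₁`, Killing-dual to `(eᵢ)`. -/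
def epsMat (i : Fin m) : Matrix (Idx m) (Idx m) ℝ := hMat m (epsD m i)

/-- The Euler element `E = diag(-1/(m+1), …, -1/(m+1), m/(m+1)) ∈ 𝔤₀`, with `ψ(E) = -Id`. -/
def EMat : Matrix (Idx m) (Idx m) ℝ :=
  Matrix.fromBlocks ((-(1 / ((m : ℝ) + 1))) • 1) 0 0 (Matrix.of fun _ _ => (m : ℝ) / ((m : ℝ) + 1))

/-- Membership in `𝔰 ≅ sl(m,ℝ) ⊂ 𝔤₀`: block diagonal with vanishing corner and traceless. -/
def inS (M : Matrix (Idx m) (Idx m) ℝ) : Prop :=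
  (∀ i, M (Sum.inl i) (Sum.inr ()) = 0) ∧ (∀ j, M (Sum.inr ()) (Sum.inl j) = 0) ∧
    M (Sum.inr ()) (Sum.inr ()) = 0 ∧ Matrix.trace M = 0

/-- Membership in `𝔤₋₁`: only the `v`-block is nonzero. -/
def inGm1 (M : Matrix (Idx m) (Idx m) ℝ) : Prop :=
  (∀ i j, M (Sum.inl i) (Sum.inl j) = 0) ∧ (∀ j, M (Sum.inr ()) (Sum.inl j) = 0) ∧
    M (Sum.inr ()) (Sum.inr ()) = 0

/-- Membership in `𝔤₁`: only the `ξ`-block is nonzero. -/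
def inG1 (M : Matrix (Idx m) (Idx m) ℝ) : Prop :=
  (∀ i j, M (Sum.inl i) (Sum.inl j) = 0) ∧ (∀ i, M (Sum.inl i) (Sum.inr ()) = 0) ∧
    M (Sum.inr ()) (Sum.inr ()) = 0

/-- Membership in `𝔤₀`: block diagonal. -/
def inG0 (M : Matrix (Idx m) (Idx m) ℝ) : Prop :=
  (∀ i, M (Sum.inl i) (Sum.inr ()) = 0) ∧ (∀ j, M (Sum.inr ()) (Sum.inl j) = 0)

/-- The Killing form of `sl(m+1,ℝ)`: `κ(M,N) = 2(m+1) tr(MN)`. -/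
def kappa (M N : Matrix (Idx m) (Idx m) ℝ) : ℝ := 2 * ((m : ℝ) + 1) * Matrix.trace (M * N)

end Matrices

section SymbolOperators

variable (m : ℕ) (V₁ V₂ : Type)
  [NormedAddCommGroup V₁] [NormedSpace ℝ V₁] [NormedAddCommGroup V₂] [NormedSpace ℝ V₂]
  (σ₁ : GLm m →ₗ[ℝ] (V₁ →L[ℝ] V₁)) (σ₂ : GLm m →ₗ[ℝ] (V₂ →L[ℝ] V₂))

/-- The operator `C₀ = (1/2)σ^{(k)}(Id) + (1/2m)σ^{(k)}(Id)² + Σ_s σ^{(k)}(ψ(h_s))∘σ^{(k)}(ψ(h_s^*))`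
on `S^k ℝ^m ⊗ Hom(V₁,V₂)`. -/
def C0op {k : ℕ} {n : ℕ} (hs hs' : Fin n → Matrix (Idx m) (Idx m) ℝ)
    (T : Symb m V₁ V₂ k) : Symb m V₁ V₂ k :=
  (1/2 : ℝ) • sigmaS m V₁ V₂ σ₁ σ₂ (ContinuousLinearMap.id ℝ (Rm m)) T
  + (1/(2*(m : ℝ))) • sigmaS m V₁ V₂ σ₁ σ₂ (ContinuousLinearMap.id ℝ (Rm m))
      (sigmaS m V₁ V₂ σ₁ σ₂ (ContinuousLinearMap.id ℝ (Rm m)) T)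
  + ∑ s, sigmaS m V₁ V₂ σ₁ σ₂ (psiC m (hs s)) (sigmaS m V₁ V₂ σ₁ σ₂ (psiC m (hs' s)) T)

/-- `C₀` acting degreewise on `⊕_{k=0}^K S^k ℝ^m ⊗ Hom(V₁,V₂)`. -/
def C0tot {K : ℕ} {n : ℕ} (hs hs' : Fin n → Matrix (Idx m) (Idx m) ℝ)
    (T : SymbT m V₁ V₂ K) : SymbT m V₁ V₂ K :=
  fun k => C0op m V₁ V₂ σ₁ σ₂ hs hs' (T k)

/-- The operator `𝓛_M = L_{X^M} + γ(ξ_M)` (flat curly Lie derivative) on functions with values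
in `⊕_{k=0}^K S^k ℝ^m ⊗ Hom(V₁,V₂)`, where `ξ_M` is the `𝔤₁`-component of `M`. -/
def curlyL {K : ℕ} (γf : ∀ k : ℕ, Dualm m → (Symb m V₁ V₂ (k+1) →ₗ[ℝ] Symb m V₁ V₂ k))
    (M : Matrix (Idx m) (Idx m) ℝ) (f : Rm m → SymbT m V₁ V₂ K) : Rm m → SymbT m V₁ V₂ K :=
  fun x => lieD m (fun B T => sigmaT m V₁ V₂ σ₁ σ₂ B T) (projVF m M) f x
    + gTot m V₁ V₂ γf (∑ j, M (Sum.inr ()) (Sum.inl j) • coordD m j) (f x)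

end SymbolOperators

section Curved

variable (m : ℕ) (P : Type) [NormedAddCommGroup P] [NormedSpace ℝ P]

/-- The invariant derivative `L_{ω^{-1}(Z)} f` along the `ω`-constant vector field `η Z`. -/
def LD (η : Matrix (Idx m) (Idx m) ℝ → P → P) (Z : Matrix (Idx m) (Idx m) ℝ)
    {V : Type} [NormedAddCommGroup V] [NormedSpace ℝ V] (f : P → V) : P → V :=
  fun u => fderiv ℝ f u (η Z u)

/-- The bracket compatibility satisfied by a normal Cartan connection: for `M ∈ 𝔤₀ ⊕ 𝔤₁` and
`N ∈ 𝔤₋₁`, `L_{ω^{-1}(M)} ∘ L_{ω^{-1}(N)} - L_{ω^{-1}(N)} ∘ L_{ω^{-1}(M)} = L_{ω^{-1}([M,N])}` on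
smooth vector-space-valued functions. -/
def BracketCompat (η : Matrix (Idx m) (Idx m) ℝ → P → P) : Prop :=
  ∀ (V : Type) [NormedAddCommGroup V] [NormedSpace ℝ V],
    ∀ f : P → V, ContDiff ℝ (⊤ : ℕ∞) f →
      ∀ M N : Matrix (Idx m) (Idx m) ℝ, Matrix.trace M = 0 → Matrix.trace N = 0 →
        (∀ i, M (Sum.inl i) (Sum.inr ()) = 0) → inGm1 m N →
        (LD m P η M (LD m P η N f) - LD m P η N (LD m P η M f)) = LD m P η (M * N - N * M) f

/-- Infinitesimal `G₀`-equivariance of `f : P → V` with respect to `σ`: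
`L_{ω^{-1}(B̃)} f = -σ(B) f` for all `B ∈ gl(m,ℝ)`. -/
def equivG0 (η : Matrix (Idx m) (Idx m) ℝ → P → P)
    {V : Type} [NormedAddCommGroup V] [NormedSpace ℝ V]
    (σ : GLm m → V → V) (f : P → V) : Prop :=
  ∀ B : GLm m, LD m P η (BTilde m B) f = fun u => -(σ B (f u))

/-- Iterated invariant derivatives along `𝔤₋₁`-constant fields. -/
def iterL (η : Matrix (Idx m) (Idx m) ℝ → P → P)
    {V : Type} [NormedAddCommGroup V] [NormedSpace ℝ V] :
    (k : ℕ) → (Fin k → Rm m) → (P → V) → (P → V)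
  | 0, _, f => f
  | (k+1), v, f => LD m P η (XMat m (v 0)) (iterL η k (fun j => v j.succ) f)

/-- The symmetrized iterated invariant differential `(∇^ω)^k f`, evaluated on
`(X₁, …, X_k) ∈ (ℝ^m)^k`. -/
def nabK (η : Matrix (Idx m) (Idx m) ℝ → P → P)
    {V : Type} [NormedAddCommGroup V] [NormedSpace ℝ V]
    (k : ℕ) (f : P → V) (v : Fin k → Rm m) : P → V :=
  fun u => (k.factorial : ℝ)⁻¹ • ∑ ν : Equiv.Perm (Fin k), iterL m P η k (v ∘ ν) f u

variable (V₁ V₂ : Type)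
  [NormedAddCommGroup V₁] [NormedSpace ℝ V₁] [NormedAddCommGroup V₂] [NormedSpace ℝ V₂]

/-- The curved quantization map: `Q_ω(T)(f)(u) = ⟨T(u), (∇^ω)^k f(u)⟩` (full contraction). -/
def Qom (η : Matrix (Idx m) (Idx m) ℝ → P → P) {k : ℕ}
    (T : P → Symb m V₁ V₂ k) (f : P → V₁) : P → V₂ :=
  fun u => (k.factorial : ℝ)⁻¹ • ∑ d : Fin k → Fin m,
    (T u (fun t => coordD m (d t))) (nabK m P η k f (fun t => Pi.single (d t) 1) u)


/-- The curved operator `N^ω f = -2 Σᵢ γ(εⁱ)(L_{ω^{-1}(eᵢ)} f)`. -/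
def Nom {K : ℕ} (γf : ∀ k : ℕ, Dualm m → (Symb m V₁ V₂ (k+1) →ₗ[ℝ] Symb m V₁ V₂ k))
    (η : Matrix (Idx m) (Idx m) ℝ → P → P) (f : P → SymbT m V₁ V₂ K) : P → SymbT m V₁ V₂ K :=
  fun u => (-2 : ℝ) • ∑ i : Fin m, gTot m V₁ V₂ γf (epsD m i)
    (LD m P η (XMat m (Pi.single i 1)) f u)

end Curved


section Powers

set_option maxSynthPendingDepth 3

variable {m : ℕ} {V₁ V₂ : Type}
  [NormedAddCommGroup V₁] [NormedSpace ℝ V₁] [NormedAddCommGroup V₂] [NormedSpace ℝ V₂]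

theorem pureT_apply {k : ℕ} (v : Fin k → Rm m) (A : V₁ →L[ℝ] V₂) (ξ : Fin k → Dualm m) :
    pureT m V₁ V₂ v A ξ = (∏ i, ξ i (v i)) • A := by
  simp [pureT]

instance finiteDimensional_symb [FiniteDimensional ℝ V₁] [FiniteDimensional ℝ V₂] (k : ℕ) :
    FiniteDimensional ℝ (Symb m V₁ V₂ k) :=
  Module.Finite.of_injective
    (ContinuousMultilinearMap.toMultilinearMapLinear :
      Symb m V₁ V₂ k →ₗ[ℝ] MultilinearMap ℝ (fun _ : Fin k => Dualm m) (V₁ →L[ℝ] V₂))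
    ContinuousMultilinearMap.toMultilinearMap_injective

/-- `pureT` as a continuous multilinear map in the vectors. -/
def pureCMM (k : ℕ) (A : V₁ →L[ℝ] V₂) :
    ContinuousMultilinearMap ℝ (fun _ : Fin k => Rm m) (Symb m V₁ V₂ k) :=
  ((ContinuousLinearMap.apply ℝ _
      (ContinuousMultilinearMap.mkPiRing ℝ (Fin k) A)).compContinuousMultilinearMap
    (ContinuousMultilinearMap.compContinuousLinearMapContinuousMultilinear ℝ
      (fun _ : Fin k => Dualm m) (fun _ : Fin k => ℝ) (V₁ →L[ℝ] V₂))).compContinuousLinearMap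
    (fun _ => ContinuousLinearMap.apply ℝ ℝ)

theorem pureCMM_apply {k : ℕ} (A : V₁ →L[ℝ] V₂) (v : Fin k → Rm m) :
    pureCMM k A v = pureT m V₁ V₂ v A := rfl

variable (m V₁ V₂) in
/-- The power `v ⊗ ⋯ ⊗ v ⊗ A` of degree `k`. -/
def powT (k : ℕ) (v : Rm m) (A : V₁ →L[ℝ] V₂) : Symb m V₁ V₂ k := pureT m V₁ V₂ (fun _ => v) A

variable (m V₁ V₂) in
/-- The derivative of `v ↦ powT k v A` in the direction `w`. -/
def dpowT (k : ℕ) (v w : Rm m) (A : V₁ →L[ℝ] V₂) : Symb m V₁ V₂ k :=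
  ∑ t : Fin k, pureT m V₁ V₂ (Function.update (fun _ => v) t w) A

theorem powT_apply {k : ℕ} (v : Rm m) (A : V₁ →L[ℝ] V₂) (ξ : Fin k → Dualm m) :
    powT m V₁ V₂ k v A ξ = (∏ i, ξ i v) • A := pureT_apply _ _ _

theorem powT_add (k : ℕ) (v : Rm m) (A B : V₁ →L[ℝ] V₂) :
    powT m V₁ V₂ k v (A + B) = powT m V₁ V₂ k v A + powT m V₁ V₂ k v B := by
  ext1 ξ; simp [powT_apply]

theorem powT_smul (k : ℕ) (v : Rm m) (c : ℝ) (A : V₁ →L[ℝ] V₂) :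
    powT m V₁ V₂ k v (c • A) = c • powT m V₁ V₂ k v A := by
  ext1 ξ; simp [powT_apply, smul_comm c]

theorem powT_sub (k : ℕ) (v : Rm m) (A B : V₁ →L[ℝ] V₂) :
    powT m V₁ V₂ k v (A - B) = powT m V₁ V₂ k v A - powT m V₁ V₂ k v B := by
  ext1 ξ; simp [powT_apply, smul_sub]

theorem hasDerivAt_diagonal {E F : Type*} [NormedAddCommGroup E] [NormedSpace ℝ E]
    [NormedAddCommGroup F] [NormedSpace ℝ F] {k : ℕ}
    (f : ContinuousMultilinearMap ℝ (fun _ : Fin k => E) F) (v w : E) :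
    HasDerivAt (fun t : ℝ => f (fun _ => v + t • w))
      (∑ i : Fin k, f (Function.update (fun _ => v) i w)) 0 := by
  have h2 : HasDerivAt (fun t : ℝ => (fun _ : Fin k => v + t • w)) (fun _ => w) 0 := by
    rw [hasDerivAt_pi]
    intro _
    simpa using ((hasDerivAt_id (0 : ℝ)).smul_const w).const_add v
  have h1 := f.hasFDerivAt (x := fun _ : Fin k => v + (0 : ℝ) • w)
  simpa [ContinuousMultilinearMap.linearDeriv_apply, Function.comp_def] using
    h1.comp_hasDerivAt (0 : ℝ) h2

theorem hasDerivAt_powT (k : ℕ) (v w : Rm m) (A : V₁ →L[ℝ] V₂) :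
    HasDerivAt (fun t : ℝ => powT m V₁ V₂ k (v + t • w) A) (dpowT m V₁ V₂ k v w A) 0 :=
  hasDerivAt_diagonal (E := Rm m) (F := Symb m V₁ V₂ k) (pureCMM k A) v w

theorem symT_smul_const (k : ℕ) (v : Rm m) (A : V₁ →L[ℝ] V₂) :
    symT m V₁ V₂ (fun _ : Fin k => v) A = (k.factorial : ℝ) • powT m V₁ V₂ k v A := by
  have : ∀ ν : Equiv.Perm (Fin k), ((fun _ : Fin k => v) ∘ ν) = fun _ => v := fun _ => rfl
  simp [symT, this, powT, Finset.sum_const, Finset.card_univ, Fintype.card_perm,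
    ← Nat.cast_smul_eq_nsmul ℝ]

theorem symT_update_smul {k : ℕ} (v : Rm m) (A : V₁ →L[ℝ] V₂) (j : Fin k) (c : ℝ) :
    symT m V₁ V₂ (Function.update (fun _ => v) j (c • v)) A
      = c • symT m V₁ V₂ (fun _ : Fin k => v) A := by
  simp only [symT, Finset.smul_sum]
  refine Finset.sum_congr rfl fun ν _ => ?_
  have h : (Function.update (fun _ => v) j (c • v)) ∘ ν
      = Function.update (fun _ => v) (ν.symm j) (c • v) := by
    funext i
    simp [Function.update_apply, Equiv.eq_symm_apply]
  have h3 := (pureCMM (m := m) k A).map_update_smul (fun _ => v) (ν.symm j) c v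
  rw [Function.update_eq_self] at h3
  rw [h]
  exact h3

theorem spanGen_eq (k : ℕ) [FiniteDimensional ℝ V₁] [FiniteDimensional ℝ V₂] :
    spanGen m V₁ V₂ k
      = Submodule.span ℝ {T | ∃ (v : Rm m) (A : V₁ →L[ℝ] V₂), T = powT m V₁ V₂ k v A} := by
  apply le_antisymm
  · refine Submodule.span_le.2 ?_
    rintro _ ⟨v, A, rfl⟩
    by_contra hcon
    obtain ⟨φ, hφ, hle⟩ := Submodule.exists_le_ker_of_notMem (SetLike.mem_coe.not.1 hcon)
    have hdiag := ((LinearMap.toContinuousLinearMap φ).compContinuousMultilinearMap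
      (pureCMM (m := m) k A)).iteratedFDeriv_comp_diagonal 0 v
    have hzero : (fun x : Rm m => ((LinearMap.toContinuousLinearMap φ).compContinuousMultilinearMap
        (pureCMM (m := m) k A)) (fun _ => x)) = fun _ => 0 := by
      funext x
      exact hle (Submodule.subset_span ⟨x, A, rfl⟩)
    rw [hzero] at hdiag
    apply hφ
    rw [symT, map_sum]
    simpa [iteratedFDeriv_fun_zero, pureCMM_apply, Function.comp_def] using hdiag.symm
  · refine Submodule.span_le.2 ?_
    rintro _ ⟨v, A, rfl⟩
    have h : powT m V₁ V₂ k v A = symT m V₁ V₂ (fun _ => v) ((k.factorial : ℝ)⁻¹ • A) := by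
      rw [symT_smul_const, powT_smul, smul_smul, mul_inv_cancel₀ (by positivity), one_smul]
    exact Submodule.subset_span ⟨_, _, h⟩

theorem spanGen_induction {k : ℕ} [FiniteDimensional ℝ V₁] [FiniteDimensional ℝ V₂]
    {p : Symb m V₁ V₂ k → Prop} (hpow : ∀ v A, p (powT m V₁ V₂ k v A)) (hzero : p 0)
    (hadd : ∀ S T, p S → p T → p (S + T)) (hsmul : ∀ (c : ℝ) T, p T → p (c • T))
    {T : Symb m V₁ V₂ k} (hT : T ∈ spanGen m V₁ V₂ k) : p T := by
  rw [spanGen_eq] at hT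
  induction hT using Submodule.span_induction with
  | mem x hx => obtain ⟨v, A, rfl⟩ := hx; exact hpow v A
  | zero => exact hzero
  | add x y _ _ hx hy => exact hadd x y hx hy
  | smul c x _ hx => exact hsmul c x hx

theorem powT_mem_spanGen (k : ℕ) [FiniteDimensional ℝ V₁] [FiniteDimensional ℝ V₂]
    (v : Rm m) (A : V₁ →L[ℝ] V₂) : powT m V₁ V₂ k v A ∈ spanGen m V₁ V₂ k := by
  rw [spanGen_eq]
  exact Submodule.subset_span ⟨v, A, rfl⟩

theorem mem_of_hasDerivAt {E : Type*} [NormedAddCommGroup E] [NormedSpace ℝ E]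
    [FiniteDimensional ℝ E] (W : Submodule ℝ E) {c : ℝ → E} {c' : E} {t : ℝ}
    (hc : HasDerivAt c c' t) (hW : ∀ s, c s ∈ W) : c' ∈ W := by
  by_contra hcon
  obtain ⟨φ, hφ, hle⟩ := Submodule.exists_le_ker_of_notMem hcon
  have h1 := (LinearMap.toContinuousLinearMap φ).hasFDerivAt.comp_hasDerivAt (f := c) t hc
  have h2 : (LinearMap.toContinuousLinearMap φ) ∘ c = fun _ => 0 := by
    funext s
    exact hle (hW s)
  rw [h2] at h1
  exact hφ (h1.unique (hasDerivAt_const t (0 : ℝ)))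

theorem dpowT_mem_spanGen (k : ℕ) [FiniteDimensional ℝ V₁] [FiniteDimensional ℝ V₂]
    (v w : Rm m) (A : V₁ →L[ℝ] V₂) : dpowT m V₁ V₂ k v w A ∈ spanGen m V₁ V₂ k :=
  mem_of_hasDerivAt _ (hasDerivAt_powT k v w A) fun _ => powT_mem_spanGen k _ A

end Powers

section Gamma

set_option maxSynthPendingDepth 3

variable {m : ℕ} {V₁ V₂ : Type}
  [NormedAddCommGroup V₁] [NormedSpace ℝ V₁] [NormedAddCommGroup V₂] [NormedSpace ℝ V₂]
  {σ₁ : GLm m →ₗ[ℝ] (V₁ →L[ℝ] V₁)} {σ₂ : GLm m →ₗ[ℝ] (V₂ →L[ℝ] V₂)}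

theorem rkOne_add (v w : Rm m) (h : Dualm m) : rkOne m (v + w) h = rkOne m v h + rkOne m w h := by
  ext; simp [rkOne, mul_add]

theorem rkOne_smul (c : ℝ) (v : Rm m) (h : Dualm m) : rkOne m (c • v) h = c • rkOne m v h := by
  ext; simp [rkOne, mul_left_comm]

theorem rkOne_add_right (v : Rm m) (h h' : Dualm m) :
    rkOne m v (h + h') = rkOne m v h + rkOne m v h' := by
  ext; simp [rkOne, add_mul]

theorem rkOne_smul_right (c : ℝ) (v : Rm m) (h : Dualm m) :
    rkOne m v (c • h) = c • rkOne m v h := by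
  ext; simp [rkOne, mul_assoc]

variable (σ₁) in
/-- The endomorphism of `V₁` with `γ(h)(v^{k+1} ⊗ A) = v^k ⊗ (A ∘ gammaEnd k h v)` for
normalized powers. -/
def gammaEnd (k : ℕ) (h : Dualm m) (v : Rm m) : V₁ →L[ℝ] V₁ :=
  σ₁ (rkOne m v h + h v • ContinuousLinearMap.id ℝ (Rm m))
    - ((k : ℝ) * h v) • ContinuousLinearMap.id ℝ V₁

theorem gammaEnd_add (k : ℕ) (h : Dualm m) (v w : Rm m) :
    gammaEnd σ₁ k h (v + w) = gammaEnd σ₁ k h v + gammaEnd σ₁ k h w := by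
  simp only [gammaEnd, rkOne_add, map_add, map_smul]
  module

theorem gammaEnd_smul (k : ℕ) (h : Dualm m) (c : ℝ) (v : Rm m) :
    gammaEnd σ₁ k h (c • v) = c • gammaEnd σ₁ k h v := by
  simp only [gammaEnd, rkOne_smul, map_add, map_smul, smul_eq_mul]
  module

theorem gammaEnd_add_left (k : ℕ) (h h' : Dualm m) (v : Rm m) :
    gammaEnd σ₁ k (h + h') v = gammaEnd σ₁ k h v + gammaEnd σ₁ k h' v := by
  simp only [gammaEnd, rkOne_add_right, map_add, map_smul, _root_.add_apply]
  module

theorem gammaEnd_smul_left (k : ℕ) (c : ℝ) (h : Dualm m) (v : Rm m) :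
    gammaEnd σ₁ k (c • h) v = c • gammaEnd σ₁ k h v := by
  simp only [gammaEnd, rkOne_smul_right, map_add, map_smul, _root_.smul_apply, smul_eq_mul]
  module

theorem card_filter_succAbove_lt {k : ℕ} (i : Fin (k + 1)) :
    (Finset.univ.filter fun j : Fin k => (i.succAbove j : ℕ) < (i : ℕ)).card = i := by
  have h : ∀ j : Fin k, ((i.succAbove j : ℕ) < (i : ℕ)) ↔ (j : ℕ) < (i : ℕ) := by
    intro j
    rw [← Fin.lt_def, Fin.succAbove_lt_iff_castSucc_lt]
    rfl
  simp only [h, Fin.card_filter_val_lt]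
  omega

theorem gamma_powT {k : ℕ} {γ : Dualm m → (Symb m V₁ V₂ (k+1) →ₗ[ℝ] Symb m V₁ V₂ k)}
    (hγ : gammaProp m V₁ V₂ σ₁ γ) (h : Dualm m) (v : Rm m) (A : V₁ →L[ℝ] V₂) :
    γ h (powT m V₁ V₂ (k + 1) v A) = powT m V₁ V₂ k v (A ∘L gammaEnd σ₁ k h v) := by
  have hγv := hγ h (fun _ => v) A
  have hrem : ∀ i : Fin (k + 1), (i.removeNth (fun _ => v) : Fin k → Rm m) = fun _ => v :=
    fun _ => rfl
  have hupd : ∀ (i : Fin (k + 1)) (j : Fin k),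
      symT m V₁ V₂ (i.removeNth (Function.update (fun _ => v) (i.succAbove j)
        (h v • v + h v • v))) A
        = (2 * h v) • symT m V₁ V₂ (fun _ : Fin k => v) A := by
    intro i j
    rw [← symT_update_smul v A j, two_mul, add_smul]
    congr 1
    funext s
    simp [Fin.removeNth, Function.update_apply]
  have hsum : (∑ i : Fin (k + 1), ((i : ℕ) : ℝ)) * 2 = (k + 1) * k := by
    rw [← Nat.cast_sum, Fin.sum_univ_eq_sum_range (fun i => i)]
    exact_mod_cast Finset.sum_range_id_mul_two (k + 1)
  simp only [hrem, hupd, ← Finset.sum_filter, Finset.sum_const, card_filter_succAbove_lt,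
    Finset.card_univ, Fintype.card_fin, ← Nat.cast_smul_eq_nsmul ℝ, ← Finset.sum_smul, symT_smul_const, map_smul, smul_smul, ← Finset.sum_mul] at hγv
  have hk : ((k + 1).factorial : ℝ) ≠ 0 := by positivity
  apply smul_right_injective _ hk
  simp only
  rw [hγv, gammaEnd, ContinuousLinearMap.comp_sub, powT_sub, ContinuousLinearMap.comp_smul,
    ContinuousLinearMap.comp_id, powT_smul, smul_sub, smul_smul, Nat.factorial_succ]
  push_cast
  congr 2
  linear_combination (h v * (k.factorial : ℝ)) * hsum

theorem gamma_dpowT [FiniteDimensional ℝ V₁] [FiniteDimensional ℝ V₂] {k : ℕ}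
    {γ : Dualm m → (Symb m V₁ V₂ (k+1) →ₗ[ℝ] Symb m V₁ V₂ k)}
    (hγ : gammaProp m V₁ V₂ σ₁ γ) (h : Dualm m) (v w : Rm m) (A : V₁ →L[ℝ] V₂) :
    γ h (dpowT m V₁ V₂ (k + 1) v w A)
      = dpowT m V₁ V₂ k v w (A ∘L gammaEnd σ₁ k h v)
        + powT m V₁ V₂ k v (A ∘L gammaEnd σ₁ k h w) := by
  have h1 := (LinearMap.toContinuousLinearMap (γ h)).hasFDerivAt.comp_hasDerivAt (0 : ℝ)
    (hasDerivAt_powT (k + 1) v w A)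
  have h2 := (hasDerivAt_powT k v w (A ∘L gammaEnd σ₁ k h v)).add
    ((hasDerivAt_id (0 : ℝ)).smul (hasDerivAt_powT k v w (A ∘L gammaEnd σ₁ k h w)))
  have h3 : (LinearMap.toContinuousLinearMap (γ h)) ∘
        (fun t : ℝ => powT m V₁ V₂ (k + 1) (v + t • w) A)
      = (fun t : ℝ => powT m V₁ V₂ k (v + t • w) (A ∘L gammaEnd σ₁ k h v))
        + ((id : ℝ → ℝ) • fun t : ℝ => powT m V₁ V₂ k (v + t • w) (A ∘L gammaEnd σ₁ k h w)) := by
    funext t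
    simp [gamma_powT hγ, gammaEnd_add, gammaEnd_smul, powT_add, powT_smul]
  rw [h3] at h1
  simpa using h1.unique h2

theorem gamma_add [FiniteDimensional ℝ V₁] [FiniteDimensional ℝ V₂] {k : ℕ}
    {γ : Dualm m → (Symb m V₁ V₂ (k+1) →ₗ[ℝ] Symb m V₁ V₂ k)}
    (hγ : gammaProp m V₁ V₂ σ₁ γ) (h h' : Dualm m) {T : Symb m V₁ V₂ (k + 1)}
    (hT : T ∈ spanGen m V₁ V₂ (k + 1)) : γ (h + h') T = γ h T + γ h' T := by
  refine spanGen_induction (p := fun T => γ (h + h') T = γ h T + γ h' T)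
    (fun v A => ?_) ?_ ?_ ?_ hT
  · simp only [gamma_powT hγ, gammaEnd_add_left, ContinuousLinearMap.comp_add, powT_add]
  · simp
  · intro S T hS hT
    simp only [map_add, hS, hT]
    abel
  · intro c T hT
    simp only [map_smul, hT, smul_add]

theorem gamma_smul [FiniteDimensional ℝ V₁] [FiniteDimensional ℝ V₂] {k : ℕ}
    {γ : Dualm m → (Symb m V₁ V₂ (k+1) →ₗ[ℝ] Symb m V₁ V₂ k)}
    (hγ : gammaProp m V₁ V₂ σ₁ γ) (c : ℝ) (h : Dualm m) {T : Symb m V₁ V₂ (k + 1)}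
    (hT : T ∈ spanGen m V₁ V₂ (k + 1)) : γ (c • h) T = c • γ h T := by
  refine spanGen_induction (p := fun T => γ (c • h) T = c • γ h T)
    (fun v A => ?_) ?_ ?_ ?_ hT
  · simp only [gamma_powT hγ, gammaEnd_smul_left, ContinuousLinearMap.comp_smul, powT_smul]
  · simp
  · intro S T hS hT
    simp only [map_add, hS, hT, smul_add]
  · intro a T hT
    simp only [map_smul, hT, smul_comm c]

theorem gammaEnd_comm (hσ₁ : IsLieRep m σ₁) (k : ℕ) (h h' : Dualm m) (v : Rm m) :
    gammaEnd σ₁ (k + 1) h v ∘L gammaEnd σ₁ k h' v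
      = gammaEnd σ₁ (k + 1) h' v ∘L gammaEnd σ₁ k h v := by
  have h1 := hσ₁ (rkOne m v h) (rkOne m v h')
  have h2 : rkOne m v h ∘L rkOne m v h' - rkOne m v h' ∘L rkOne m v h
      = h v • rkOne m v h' - h' v • rkOne m v h := by
    ext
    simp [rkOne]
    ring
  have hc : ∀ B, σ₁ B ∘L σ₁ (ContinuousLinearMap.id ℝ (Rm m))
      = σ₁ (ContinuousLinearMap.id ℝ (Rm m)) ∘L σ₁ B := by
    intro B
    have := hσ₁ B (ContinuousLinearMap.id ℝ (Rm m))
    rw [ContinuousLinearMap.comp_id, ContinuousLinearMap.id_comp, sub_self, map_zero] at this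
    exact (sub_eq_zero.1 this.symm)
  rw [h2, map_sub, map_smul, map_smul] at h1
  have h3 : σ₁ (rkOne m v h) ∘L σ₁ (rkOne m v h')
      = h v • σ₁ (rkOne m v h') - h' v • σ₁ (rkOne m v h)
        + σ₁ (rkOne m v h') ∘L σ₁ (rkOne m v h) := by
    rw [h1]; abel
  simp only [gammaEnd, map_add, map_smul, ContinuousLinearMap.comp_sub,
    ContinuousLinearMap.sub_comp, ContinuousLinearMap.comp_add, ContinuousLinearMap.add_comp,
    ContinuousLinearMap.comp_smul, ContinuousLinearMap.smul_comp, ContinuousLinearMap.comp_id,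
    ContinuousLinearMap.id_comp, h3, hc]
  push_cast
  module

theorem gamma_comm [FiniteDimensional ℝ V₁] [FiniteDimensional ℝ V₂] (hσ₁ : IsLieRep m σ₁)
    {k : ℕ} {γ : Dualm m → (Symb m V₁ V₂ (k+1) →ₗ[ℝ] Symb m V₁ V₂ k)}
    {γ' : Dualm m → (Symb m V₁ V₂ (k+1+1) →ₗ[ℝ] Symb m V₁ V₂ (k+1))}
    (hγ : gammaProp m V₁ V₂ σ₁ γ) (hγ' : gammaProp m V₁ V₂ σ₁ γ') (h h' : Dualm m)
    {T : Symb m V₁ V₂ (k + 1 + 1)} (hT : T ∈ spanGen m V₁ V₂ (k + 1 + 1)) :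
    γ h (γ' h' T) = γ h' (γ' h T) := by
  refine spanGen_induction (p := fun T => γ h (γ' h' T) = γ h' (γ' h T))
    (fun v A => ?_) ?_ ?_ ?_ hT
  · simp only [gamma_powT hγ, gamma_powT hγ', ContinuousLinearMap.comp_assoc,
      gammaEnd_comm hσ₁ k h h' v]
  · simp
  · intro S T hS hT
    simp only [map_add, hS, hT]
  · intro a T hT
    simp only [map_smul, hT]

end Gamma

section Sigma

set_option maxSynthPendingDepth 3

variable {m : ℕ} {V₁ V₂ : Type}
  [NormedAddCommGroup V₁] [NormedSpace ℝ V₁] [NormedAddCommGroup V₂] [NormedSpace ℝ V₂]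
  {σ₁ : GLm m →ₗ[ℝ] (V₁ →L[ℝ] V₁)} {σ₂ : GLm m →ₗ[ℝ] (V₂ →L[ℝ] V₂)}

theorem sigmaS_apply {k : ℕ} (B : GLm m) (T : Symb m V₁ V₂ k) (ξ : Fin k → Dualm m) :
    sigmaS m V₁ V₂ σ₁ σ₂ B T ξ
      = (∑ t : Fin k, T (Function.update ξ t ((ξ t) ∘L B)))
        + (σ₂ B ∘L T ξ - T ξ ∘L σ₁ B) := by
  have h : ∀ t : Fin k, (fun s => (if s = t then
      (ContinuousLinearMap.compL ℝ (Rm m) (Rm m) ℝ).flip B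
      else ContinuousLinearMap.id ℝ (Dualm m)) (ξ s)) = Function.update ξ t ((ξ t) ∘L B) := by
    intro t
    funext s
    by_cases hs : s = t
    · subst hs; simp
    · simp [hs]
  simp [sigmaS, h]

theorem sigmaS_add {k : ℕ} (B : GLm m) (S T : Symb m V₁ V₂ k) :
    sigmaS m V₁ V₂ σ₁ σ₂ B (S + T) = sigmaS m V₁ V₂ σ₁ σ₂ B S + sigmaS m V₁ V₂ σ₁ σ₂ B T := by
  ext1 ξ
  simp only [sigmaS_apply, _root_.add_apply, Finset.sum_add_distrib,
    ContinuousLinearMap.comp_add, ContinuousLinearMap.add_comp]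
  abel

theorem sigmaS_smul {k : ℕ} (B : GLm m) (c : ℝ) (T : Symb m V₁ V₂ k) :
    sigmaS m V₁ V₂ σ₁ σ₂ B (c • T) = c • sigmaS m V₁ V₂ σ₁ σ₂ B T := by
  ext1 ξ
  simp only [sigmaS_apply, _root_.smul_apply, ← Finset.smul_sum,
    ContinuousLinearMap.comp_smul, ContinuousLinearMap.smul_comp, smul_add, smul_sub]

theorem sigmaS_add_left {k : ℕ} (B C : GLm m) (T : Symb m V₁ V₂ k) :
    sigmaS m V₁ V₂ σ₁ σ₂ (B + C) T = sigmaS m V₁ V₂ σ₁ σ₂ B T + sigmaS m V₁ V₂ σ₁ σ₂ C T := by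
  ext1 ξ
  simp only [sigmaS_apply, _root_.add_apply, map_add,
    ContinuousLinearMap.comp_add, ContinuousLinearMap.add_comp,
    ContinuousMultilinearMap.map_update_add, Finset.sum_add_distrib]
  abel

theorem sigmaS_smul_left {k : ℕ} (B : GLm m) (c : ℝ) (T : Symb m V₁ V₂ k) :
    sigmaS m V₁ V₂ σ₁ σ₂ (c • B) T = c • sigmaS m V₁ V₂ σ₁ σ₂ B T := by
  ext1 ξ
  simp only [sigmaS_apply, _root_.smul_apply, map_smul,
    ContinuousLinearMap.comp_smul, ContinuousLinearMap.smul_comp,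
    ContinuousMultilinearMap.map_update_smul, ← Finset.smul_sum, smul_add, smul_sub]

variable (σ₁ σ₂) in
/-- `sigmaS` as a bilinear map. -/
def sigmaL (k : ℕ) : GLm m →ₗ[ℝ] Symb m V₁ V₂ k →ₗ[ℝ] Symb m V₁ V₂ k :=
  LinearMap.mk₂ ℝ (sigmaS m V₁ V₂ σ₁ σ₂) sigmaS_add_left
    (fun c B T => sigmaS_smul_left B c T) sigmaS_add (fun c B T => sigmaS_smul B c T)

theorem sigmaL_apply {k : ℕ} (B : GLm m) (T : Symb m V₁ V₂ k) :
    sigmaL σ₁ σ₂ k B T = sigmaS m V₁ V₂ σ₁ σ₂ B T := rfl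

theorem sigmaL_powT {k : ℕ} (B : GLm m) (v : Rm m) (A : V₁ →L[ℝ] V₂) :
    sigmaL σ₁ σ₂ k B (powT m V₁ V₂ k v A)
      = dpowT m V₁ V₂ k v (B v) A + powT m V₁ V₂ k v (σ₂ B ∘L A - A ∘L σ₁ B) := by
  have h : ∀ (ξ : Fin k → Dualm m) (t : Fin k),
      (∏ i, Function.update ξ t (ξ t ∘L B) i v)
        = ∏ i, ξ i (Function.update (fun _ => v) t (B v) i) := by
    intro ξ t
    refine Finset.prod_congr rfl fun i _ => ?_
    by_cases hi : i = t
    · subst hi; simp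
    · simp [hi]
  ext1 ξ
  simp [sigmaL_apply, sigmaS_apply, dpowT, powT_apply, pureT_apply,
    h, smul_sub]

theorem sigmaL_mem [FiniteDimensional ℝ V₁] [FiniteDimensional ℝ V₂] {k : ℕ} (B : GLm m)
    {T : Symb m V₁ V₂ k} (hT : T ∈ spanGen m V₁ V₂ k) :
    sigmaL σ₁ σ₂ k B T ∈ spanGen m V₁ V₂ k := by
  refine spanGen_induction (p := fun T => sigmaL σ₁ σ₂ k B T ∈ spanGen m V₁ V₂ k)
    (fun v A => ?_) ?_ ?_ ?_ hT
  · simp only [sigmaL_powT]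
    exact add_mem (dpowT_mem_spanGen _ _ _ _) (powT_mem_spanGen _ _ _)
  · simp
  · intro S T hS hT
    simpa using add_mem hS hT
  · intro c T hT
    simpa using Submodule.smul_mem _ c hT

theorem gammaEnd_comp (hσ₁ : IsLieRep m σ₁) (k : ℕ) (h : Dualm m) (B : GLm m) (v : Rm m) :
    gammaEnd σ₁ k h (B v)
      = gammaEnd σ₁ k (h ∘L B) v + σ₁ B ∘L gammaEnd σ₁ k h v - gammaEnd σ₁ k h v ∘L σ₁ B := by
  have h1 := hσ₁ B (rkOne m v h + h v • ContinuousLinearMap.id ℝ (Rm m))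
  have h2 : B ∘L (rkOne m v h + h v • ContinuousLinearMap.id ℝ (Rm m))
      - (rkOne m v h + h v • ContinuousLinearMap.id ℝ (Rm m)) ∘L B
      = (rkOne m (B v) h + h (B v) • ContinuousLinearMap.id ℝ (Rm m))
        - (rkOne m v (h ∘L B) + (h ∘L B) v • ContinuousLinearMap.id ℝ (Rm m)) := by
    ext
    simp [rkOne]
  rw [h2, map_sub, sub_eq_iff_eq_add] at h1
  rw [gammaEnd, h1, gammaEnd, gammaEnd]
  simp only [ContinuousLinearMap.comp_sub, ContinuousLinearMap.sub_comp,
    ContinuousLinearMap.comp_smul, ContinuousLinearMap.smul_comp, ContinuousLinearMap.comp_id,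
    ContinuousLinearMap.id_comp, ContinuousLinearMap.comp_apply]
  abel

theorem gamma_sigmaL [FiniteDimensional ℝ V₁] [FiniteDimensional ℝ V₂] (hσ₁ : IsLieRep m σ₁)
    {k : ℕ} {γ : Dualm m → (Symb m V₁ V₂ (k+1) →ₗ[ℝ] Symb m V₁ V₂ k)}
    (hγ : gammaProp m V₁ V₂ σ₁ γ) (h : Dualm m) (B : GLm m)
    {T : Symb m V₁ V₂ (k + 1)} (hT : T ∈ spanGen m V₁ V₂ (k + 1)) :
    γ h (sigmaL σ₁ σ₂ (k + 1) B T) = sigmaL σ₁ σ₂ k B (γ h T) + γ (h ∘L B) T := by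
  refine spanGen_induction (p := fun T => γ h (sigmaL σ₁ σ₂ (k + 1) B T)
    = sigmaL σ₁ σ₂ k B (γ h T) + γ (h ∘L B) T) (fun v A => ?_) ?_ ?_ ?_ hT
  · simp only [gamma_powT hγ, sigmaL_powT, map_add, gamma_dpowT hγ]
    rw [add_assoc, add_assoc, ← powT_add, ← powT_add, gammaEnd_comp hσ₁]
    congr 2
    simp only [ContinuousLinearMap.comp_sub, ContinuousLinearMap.sub_comp,
      ContinuousLinearMap.comp_add, ContinuousLinearMap.comp_assoc]
    abel
  · simp
  · intro S T hS hT
    simp only [map_add, hS, hT]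
    abel
  · intro a T hT
    simp only [map_smul, hT, smul_add]

end Sigma

section Casimir

set_option maxSynthPendingDepth 3

variable {m : ℕ} {V₁ V₂ : Type}
  [NormedAddCommGroup V₁] [NormedSpace ℝ V₁] [NormedAddCommGroup V₂] [NormedSpace ℝ V₂]
  {σ₁ : GLm m →ₗ[ℝ] (V₁ →L[ℝ] V₁)} {σ₂ : GLm m →ₗ[ℝ] (V₂ →L[ℝ] V₂)}

variable (m) in
/-- The elementary endomorphism with matrix unit `(i, j)`. -/
def unitE (i j : Fin m) : GLm m := rkOne m (Pi.single i 1) (coordD m j)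

theorem sum_unitE : ∑ i, unitE m i i = ContinuousLinearMap.id ℝ (Rm m) := by
  ext x i
  simp [unitE, rkOne, coordD, Pi.single_apply]

theorem dual_eq_sum (h : Dualm m) : h = ∑ j, h (Pi.single j 1) • coordD m j := by
  ext x
  rw [← ContinuousLinearMap.coe_coe, LinearMap.pi_apply_eq_sum_univ]
  simp [coordD, mul_comm, ← Pi.single_apply, Pi.single_comm]

theorem rkOne_eq_sum (u : Rm m) (h : Dualm m) :
    rkOne m u h = ∑ j, h (Pi.single j 1) • rkOne m u (coordD m j) := by
  ext x i
  have := DFunLike.congr_fun (dual_eq_sum h) x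
  simp only [sum_apply, smul_apply, smul_eq_mul] at this
  simp [rkOne, this, Finset.sum_mul, mul_assoc]

theorem comp_unitE (h : Dualm m) (i j : Fin m) :
    h ∘L unitE m i j = h (Pi.single i 1) • coordD m j := by
  ext x
  simp [unitE, rkOne, coordD, mul_comm]

variable (m) in
/-- `psiC` as a linear map. -/
def psiL : Matrix (Idx m) (Idx m) ℝ →ₗ[ℝ] GLm m where
  toFun := psiC m
  map_add' M N := by
    ext x i
    simp [psiC, Matrix.mulVec, dotProduct, add_mul, Finset.sum_add_distrib]
    ring
  map_smul' c M := by
    ext x i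
    simp [psiC, Matrix.mulVec, dotProduct, mul_assoc, ← Finset.mul_sum]
    ring

theorem psiL_apply (M : Matrix (Idx m) (Idx m) ℝ) : psiL m M = psiC m M := rfl

theorem psiC_eq_sum {M : Matrix (Idx m) (Idx m) ℝ} (hM : inS m M) :
    psiC m M = ∑ i, ∑ j, M (Sum.inl i) (Sum.inl j) • unitE m i j := by
  ext x i
  simp [psiC, Matrix.mulVec, dotProduct, hM.2.2.1, unitE, rkOne, coordD, Pi.single_apply]

variable (m) in
/-- The element of `𝔰` that pairs with `M ∈ 𝔰` to its `(i, j)` entry, up to a factor. -/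
def entryDual (i j : Fin m) : Matrix (Idx m) (Idx m) ℝ :=
  Matrix.fromBlocks (Matrix.single j i 1 - (if i = j then 1 / (m : ℝ) else 0) • 1) 0 0 0

theorem inS_entryDual (hm : m ≠ 0) (i j : Fin m) : inS m (entryDual m i j) := by
  refine ⟨fun _ => rfl, fun _ => rfl, rfl, ?_⟩
  have hm' : (m : ℝ) ≠ 0 := by exact_mod_cast hm
  by_cases h : i = j
  · subst h
    simp [entryDual, Matrix.trace, hm', Matrix.single_apply]
  · simp [entryDual, Matrix.trace, h, Matrix.single_apply, ite_and]

theorem kappa_entryDual {M : Matrix (Idx m) (Idx m) ℝ} (hM : inS m M) (i j : Fin m) :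
    kappa m (entryDual m i j) M = 2 * ((m : ℝ) + 1) * M (Sum.inl i) (Sum.inl j) := by
  have htr : ∑ a : Fin m, M (Sum.inl a) (Sum.inl a) = 0 := by
    simpa [Matrix.trace, hM.2.2.1] using hM.2.2.2
  have h : Matrix.trace (entryDual m i j * M) = M (Sum.inl i) (Sum.inl j) := by
    by_cases hij : i = j <;>
    simp [Matrix.trace, entryDual, Matrix.mul_apply, Matrix.single_apply, sub_mul,
      Finset.sum_sub_distrib, Matrix.one_apply, ← Finset.mul_sum, htr, ite_and, hij]
  rw [kappa, h]

theorem psiC_entryDual (i j : Fin m) :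
    psiC m (entryDual m i j)
      = unitE m j i - (if i = j then 1 / (m : ℝ) else 0) • ContinuousLinearMap.id ℝ (Rm m) := by
  ext x a
  by_cases hij : i = j <;>
  simp [psiC, entryDual, Matrix.mulVec, dotProduct, unitE, rkOne, coordD, sub_mul,
    Finset.sum_sub_distrib, Matrix.single_apply, Matrix.one_apply, Pi.single_apply, ite_and,
    @eq_comm _ a, hij]

theorem sum_casimir {E : Type*} [AddCommGroup E] [Module ℝ E] (hm : m ≠ 0) {n : ℕ}
    {hs hs' : Fin n → Matrix (Idx m) (Idx m) ℝ} (hmem' : ∀ s, inS m (hs' s))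
    (hcompl : ∀ Y, inS m Y → (∑ s, kappa m Y (hs' s) • hs s) = Y)
    (F : GLm m →ₗ[ℝ] GLm m →ₗ[ℝ] E) :
    ∑ s, F (psiC m (hs s)) (psiC m (hs' s))
      = (1 / (2 * ((m : ℝ) + 1))) • ((∑ i, ∑ j, F (unitE m i j) (unitE m j i))
        - (1 / (m : ℝ)) • F (ContinuousLinearMap.id ℝ (Rm m)) (ContinuousLinearMap.id ℝ (Rm m))) := by
  have hpos : (2 * ((m : ℝ) + 1)) ≠ 0 := by positivity
  have h1 : ∀ i j, ∑ s, hs' s (Sum.inl i) (Sum.inl j) • psiC m (hs s)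
      = (1 / (2 * ((m : ℝ) + 1))) • psiC m (entryDual m i j) := by
    intro i j
    rw [← psiL_apply, ← hcompl _ (inS_entryDual hm i j), map_sum, Finset.smul_sum]
    refine Finset.sum_congr rfl fun s _ => ?_
    rw [kappa_entryDual (hmem' s), map_smul, smul_smul, ← mul_assoc, one_div,
      inv_mul_cancel₀ hpos, one_mul, psiL_apply]
  calc ∑ s, F (psiC m (hs s)) (psiC m (hs' s))
      = ∑ i, ∑ j, F (∑ s, hs' s (Sum.inl i) (Sum.inl j) • psiC m (hs s)) (unitE m i j) := by
        simp only [psiC_eq_sum (hmem' _), map_sum, map_smul, LinearMap.sum_apply,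
          LinearMap.smul_apply]
        rw [Finset.sum_comm]
        exact Finset.sum_congr rfl fun i _ => Finset.sum_comm
    _ = (1 / (2 * ((m : ℝ) + 1))) • ((∑ i, ∑ j, F (unitE m j i) (unitE m i j))
        - (1 / (m : ℝ)) • ∑ i, F (ContinuousLinearMap.id ℝ (Rm m)) (unitE m i i)) := by
        simp only [h1, psiC_entryDual, map_smul, map_sub, LinearMap.smul_apply,
          LinearMap.sub_apply, ← Finset.smul_sum, Finset.sum_sub_distrib]
        simp only [ite_smul, zero_smul, Finset.sum_ite_eq, Finset.mem_univ, if_true,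
          ← Finset.smul_sum]
    _ = _ := by
        rw [← map_sum, sum_unitE, Finset.sum_comm]

theorem gamma_C0op [FiniteDimensional ℝ V₁] [FiniteDimensional ℝ V₂] (hσ₁ : IsLieRep m σ₁)
    {k : ℕ} {γ : Dualm m → (Symb m V₁ V₂ (k+1) →ₗ[ℝ] Symb m V₁ V₂ k)}
    (hγ : gammaProp m V₁ V₂ σ₁ γ) (hm : m ≠ 0) {n : ℕ}
    {hs hs' : Fin n → Matrix (Idx m) (Idx m) ℝ} (hmem' : ∀ s, inS m (hs' s))
    (hcompl : ∀ Y, inS m Y → (∑ s, kappa m Y (hs' s) • hs s) = Y) (h : Dualm m)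
    {T : Symb m V₁ V₂ (k + 1)} (hT : T ∈ spanGen m V₁ V₂ (k + 1)) :
    γ h (C0op m V₁ V₂ σ₁ σ₂ hs hs' T)
      = C0op m V₁ V₂ σ₁ σ₂ hs hs' (γ h T)
        + (2 : ℝ) • ∑ i, γ (epsD m i) (sigmaS m V₁ V₂ σ₁ σ₂
          (rkOne m (Pi.single i 1) h + h (Pi.single i 1) • ContinuousLinearMap.id ℝ (Rm m)) T) := by
  have ga : ∀ (h h' : Dualm m) (B : GLm m), γ (h + h') (sigmaL σ₁ σ₂ (k + 1) B T)
      = γ h (sigmaL σ₁ σ₂ (k + 1) B T) + γ h' (sigmaL σ₁ σ₂ (k + 1) B T) :=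
    fun h h' B => gamma_add hγ h h' (sigmaL_mem B hT)
  have gs : ∀ (c : ℝ) (h : Dualm m) (B : GLm m), γ (c • h) (sigmaL σ₁ σ₂ (k + 1) B T)
      = c • γ h (sigmaL σ₁ σ₂ (k + 1) B T) := fun c h B => gamma_smul hγ c h (sigmaL_mem B hT)
  have ga' : ∀ (h h' : Dualm m), γ (h + h') T = γ h T + γ h' T := fun h h' => gamma_add hγ h h' hT
  have gs' : ∀ (c : ℝ) (h : Dualm m), γ (c • h) T = c • γ h T := fun c h => gamma_smul hγ c h hT
  let F : GLm m →ₗ[ℝ] GLm m →ₗ[ℝ] Symb m V₁ V₂ k := LinearMap.mk₂ ℝ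
    (fun A A' => γ (h ∘L A') (sigmaL σ₁ σ₂ (k + 1) A T) - γ ((h ∘L A') ∘L A) T
      + γ (h ∘L A) (sigmaL σ₁ σ₂ (k + 1) A' T))
    (fun A B C => by
      simp only [map_add, LinearMap.add_apply, ContinuousLinearMap.comp_add, ga, ga']; abel)
    (fun c A B => by
      simp only [map_smul, LinearMap.smul_apply, ContinuousLinearMap.comp_smul, gs, gs', smul_add,
        smul_sub])
    (fun A B C => by
      simp only [map_add, LinearMap.add_apply, ContinuousLinearMap.comp_add,
        ContinuousLinearMap.add_comp, ga, ga']; abel)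
    (fun c A B => by
      simp only [map_smul, LinearMap.smul_apply, ContinuousLinearMap.comp_smul,
        ContinuousLinearMap.smul_comp, gs, gs', smul_add, smul_sub])
  have hF : ∀ A A', F A A' = γ (h ∘L A') (sigmaL σ₁ σ₂ (k + 1) A T) - γ ((h ∘L A') ∘L A) T
      + γ (h ∘L A) (sigmaL σ₁ σ₂ (k + 1) A' T) := fun _ _ => rfl
  have hswap : ∀ A A', γ h (sigmaL σ₁ σ₂ (k + 1) A (sigmaL σ₁ σ₂ (k + 1) A' T))
      = sigmaL σ₁ σ₂ k A (sigmaL σ₁ σ₂ k A' (γ h T)) + F A A' := by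
    intro A A'
    rw [hF, gamma_sigmaL hσ₁ hγ _ _ (sigmaL_mem A' hT), gamma_sigmaL hσ₁ hγ h A' hT, map_add,
      gamma_sigmaL hσ₁ hγ _ A hT]
    abel
  let S := ∑ j, γ (coordD m j) (sigmaL σ₁ σ₂ (k + 1) (rkOne m (Pi.single j 1) h) T)
  have hS : ∑ i, ∑ j, h (Pi.single j 1) •
      γ (coordD m i) (sigmaL σ₁ σ₂ (k + 1) (unitE m i j) T) = S := by
    refine Finset.sum_congr rfl fun i _ => ?_
    rw [rkOne_eq_sum _ h]
    simp only [map_sum, map_smul, LinearMap.sum_apply, LinearMap.smul_apply, unitE]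
  have hX : ∑ j, h (Pi.single j 1) • γ (coordD m j) T = γ h T := by
    let g : Dualm m →ₗ[ℝ] Symb m V₁ V₂ k :=
      { toFun := fun h => γ h T, map_add' := ga', map_smul' := gs' }
    have hg : g h = ∑ j, h (Pi.single j 1) • g (coordD m j) := by
      conv_lhs => rw [dual_eq_sum h]
      simp only [map_sum, map_smul]
    exact hg.symm
  have hZ : ∑ j, h (Pi.single j 1) • γ (coordD m j)
      (sigmaL σ₁ σ₂ (k + 1) (ContinuousLinearMap.id ℝ (Rm m)) T)
      = γ h (sigmaL σ₁ σ₂ (k + 1) (ContinuousLinearMap.id ℝ (Rm m)) T) := by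
    let g : Dualm m →ₗ[ℝ] Symb m V₁ V₂ k :=
      { toFun := fun h => γ h (sigmaL σ₁ σ₂ (k + 1) (ContinuousLinearMap.id ℝ (Rm m)) T),
        map_add' := fun h h' => ga h h' _, map_smul' := fun c h => gs c h _ }
    have hg : g h = ∑ j, h (Pi.single j 1) • g (coordD m j) := by
      conv_lhs => rw [dual_eq_sum h]
      simp only [map_sum, map_smul]
    exact hg.symm
  have hFsum : ∑ i, ∑ j, F (unitE m i j) (unitE m j i) = S - (m : ℝ) • γ h T + S := by
    have hone : ∀ j : Fin m, coordD m j (Pi.single j 1) = 1 := fun j => by simp [coordD]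
    simp only [hF, comp_unitE, gs, gs', ContinuousLinearMap.smul_comp, Finset.sum_add_distrib,
      Finset.sum_sub_distrib, smul_smul]
    rw [hS, Finset.sum_comm (f := fun i j => h (Pi.single i 1) •
      γ (coordD m j) (sigmaL σ₁ σ₂ (k + 1) (unitE m j i) T)), hS]
    simp only [hone, mul_one, hX, Finset.sum_const, Finset.card_univ, Fintype.card_fin,
      Nat.cast_smul_eq_nsmul]
  have hid : F (ContinuousLinearMap.id ℝ (Rm m)) (ContinuousLinearMap.id ℝ (Rm m))
      = (2 : ℝ) • γ h (sigmaL σ₁ σ₂ (k + 1) (ContinuousLinearMap.id ℝ (Rm m)) T) - γ h T := by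
    simp only [hF, ContinuousLinearMap.comp_id]
    module
  have hcas := sum_casimir hm hmem' hcompl F
  have hone := gamma_sigmaL (σ₂ := σ₂) hσ₁ hγ h (ContinuousLinearMap.id ℝ (Rm m)) hT
  rw [ContinuousLinearMap.comp_id] at hone
  have hR : ∑ i, γ (epsD m i) (sigmaS m V₁ V₂ σ₁ σ₂
          (rkOne m (Pi.single i 1) h + h (Pi.single i 1) • ContinuousLinearMap.id ℝ (Rm m)) T)
      = (1 / (2 * ((m : ℝ) + 1))) •
        (S + γ h (sigmaL σ₁ σ₂ (k + 1) (ContinuousLinearMap.id ℝ (Rm m)) T)) := by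
    simp only [← sigmaL_apply, epsD, gs, ← Finset.smul_sum]
    rw [← hZ]
    simp only [map_add, map_smul, LinearMap.add_apply, LinearMap.smul_apply,
      Finset.sum_add_distrib, S]
  have hm' : (m : ℝ) ≠ 0 := by exact_mod_cast hm
  have hm1 : (m : ℝ) + 1 ≠ 0 := by positivity
  rw [hR]
  simp only [C0op, ← sigmaL_apply, map_add, map_smul, map_sum, hswap, Finset.sum_add_distrib, hcas,
    hFsum, hid, hone]
  match_scalars <;> field_simp <;> ring

end Casimir

section Invariant

variable {m : ℕ} {P : Type} [NormedAddCommGroup P] [NormedSpace ℝ P]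
  {E : Type} [NormedAddCommGroup E] [NormedSpace ℝ E]
  {η : Matrix (Idx m) (Idx m) ℝ → P → P}

theorem contDiff_LD (hη : ∀ Z, ContDiff ℝ (⊤ : ℕ∞) (η Z)) (Z : Matrix (Idx m) (Idx m) ℝ)
    {f : P → E} (hf : ContDiff ℝ (⊤ : ℕ∞) f) : ContDiff ℝ (⊤ : ℕ∞) (LD m P η Z f) :=
  (hf.fderiv_right (m := (⊤ : ℕ∞)) (by norm_cast)).clm_apply (hη Z)

theorem LD_add (Z : Matrix (Idx m) (Idx m) ℝ) {f g : P → E} {u : P}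
    (hf : DifferentiableAt ℝ f u) (hg : DifferentiableAt ℝ g u) :
    LD m P η Z (fun w => f w + g w) u = LD m P η Z f u + LD m P η Z g u := by
  simp only [LD]
  rw [fderiv_fun_add hf hg]
  rfl

theorem LD_clm {F : Type} [NormedAddCommGroup F] [NormedSpace ℝ F] (L : E →L[ℝ] F)
    (Z : Matrix (Idx m) (Idx m) ℝ) {f : P → E} {u : P} (hf : DifferentiableAt ℝ f u) :
    LD m P η Z (fun w => L (f w)) u = L (LD m P η Z f u) := by
  simp only [LD]
  exact DFunLike.congr_fun (L.hasFDerivAt.comp u hf.hasFDerivAt).fderiv (η Z u)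

theorem LD_mem [FiniteDimensional ℝ E] (W : Submodule ℝ E) (Z : Matrix (Idx m) (Idx m) ℝ)
    {f : P → E} {u : P} (hf : DifferentiableAt ℝ f u) (hW : ∀ w, f w ∈ W) :
    LD m P η Z f u ∈ W :=
  mem_of_hasDerivAt W (hf.hasFDerivAt.hasLineDerivAt (η Z u)) fun _ => hW _

/-- An abstract form of the commutation of `L_{ω^{-1}(h)} + γ(h)` with `C₀ + N^ω`. -/
theorem commute_of_bracket {ι : Type*} [Fintype ι] (hη : ∀ Z, ContDiff ℝ (⊤ : ℕ∞) (η Z))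
    {f : P → E} (hf : ContDiff ℝ (⊤ : ℕ∞) f) (C Γ : E →L[ℝ] E) (Γ' : ι → E →L[ℝ] E)
    (H : Matrix (Idx m) (Idx m) ℝ) (X : ι → Matrix (Idx m) (Idx m) ℝ) (a : ι → P → E)
    (hbr : ∀ i u, LD m P η H (LD m P η (X i) f) u = LD m P η (X i) (LD m P η H f) u + a i u)
    (hΓ : ∀ i u, Γ (Γ' i (LD m P η (X i) f u)) = Γ' i (Γ (LD m P η (X i) f u)))
    (hC : ∀ u, Γ (C (f u)) = C (Γ (f u)) + (2 : ℝ) • ∑ i, Γ' i (a i u)) (u : P) :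
    LD m P η H (fun w => C (f w) + (-2 : ℝ) • ∑ i, Γ' i (LD m P η (X i) f w)) u
        + Γ (C (f u) + (-2 : ℝ) • ∑ i, Γ' i (LD m P η (X i) f u))
      = C (LD m P η H f u + Γ (f u))
        + (-2 : ℝ) • ∑ i, Γ' i (LD m P η (X i) (fun w => LD m P η H f w + Γ (f w)) u) := by
  have hd : ∀ Z, Differentiable ℝ (LD m P η Z f) := fun Z =>
    (contDiff_LD hη Z hf).differentiable (by simp)
  have hfd : Differentiable ℝ f := hf.differentiable (by simp)
  have hcomp : ∀ (L : E →L[ℝ] E) {g : P → E}, Differentiable ℝ g →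
      Differentiable ℝ fun w => L (g w) := fun L _ hg => L.differentiable.comp hg
  have hsum : LD m P η H (fun w => ∑ i, Γ' i (LD m P η (X i) f w)) u
      = ∑ i, Γ' i (LD m P η H (LD m P η (X i) f) u) := by
    rw [LD, fderiv_fun_sum fun i _ => hcomp (Γ' i) (hd (X i)) u, sum_apply]
    exact Finset.sum_congr rfl fun i _ => LD_clm (Γ' i) H (hd (X i) u)
  have hsd : Differentiable ℝ fun w => ∑ i, Γ' i (LD m P η (X i) f w) :=
    Differentiable.fun_sum fun i _ => hcomp (Γ' i) (hd (X i))
  have hN : LD m P η H (fun w => (-2 : ℝ) • ∑ i, Γ' i (LD m P η (X i) f w)) u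
      = (-2 : ℝ) • ∑ i, Γ' i (LD m P η H (LD m P η (X i) f) u) := by
    rw [← hsum]
    exact LD_clm ((-2 : ℝ) • ContinuousLinearMap.id ℝ E) H (hsd u)
  have hR : ∀ i, LD m P η (X i) (fun w => LD m P η H f w + Γ (f w)) u
      = LD m P η (X i) (LD m P η H f) u + Γ (LD m P η (X i) f u) := fun i => by
    rw [LD_add _ (hd H u) (hcomp Γ hfd u), LD_clm Γ _ (hfd u)]
  rw [LD_add (g := fun w => (-2 : ℝ) • ∑ i, Γ' i (LD m P η (X i) f w)) H
    (hcomp C hfd u) ((hsd u).const_smul _), LD_clm C _ (hfd u), hN]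
  simp only [hR, hbr, map_add, map_smul, map_sum, hΓ, hC, Finset.sum_add_distrib]
  module

theorem trace_rkOne (u : Rm m) (h : Dualm m) :
    LinearMap.trace ℝ (Rm m) (rkOne m u h : (Fin m → ℝ) →ₗ[ℝ] (Fin m → ℝ)) = h u :=
  LinearMap.trace_smulRight (h : (Fin m → ℝ) →ₗ[ℝ] ℝ) u

theorem bracket_hMat_XMat (h : Dualm m) (X : Rm m) :
    hMat m h * XMat m X - XMat m X * hMat m h
      = BTilde m (-(rkOne m X h + h X • ContinuousLinearMap.id ℝ (Rm m))) := by
  have hX : h X = ∑ i, h (Pi.single i 1) * X i := by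
    simpa [coordD] using DFunLike.congr_fun (dual_eq_sum h) X
  have htr : LinearMap.trace ℝ (Rm m) ((-(rkOne m X h + h X • ContinuousLinearMap.id ℝ (Rm m)) :
      GLm m) : (Fin m → ℝ) →ₗ[ℝ] (Fin m → ℝ)) = -(h X * ((m : ℝ) + 1)) := by
    simp only [ContinuousLinearMap.toLinearMap_neg, ContinuousLinearMap.toLinearMap_add,
      ContinuousLinearMap.toLinearMap_smul, ContinuousLinearMap.coe_id, map_neg, map_add,
      map_smul, trace_rkOne, LinearMap.trace_id, Module.finrank_fin_fun, smul_eq_mul]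
    ring
  have hm1 : (m : ℝ) + 1 ≠ 0 := by positivity
  rw [BTilde, htr, neg_div, mul_div_cancel_right₀ _ hm1, neg_neg, neg_smul, sub_neg_eq_add]
  ext (i | i) (j | j)
  · simp [hMat, XMat, Matrix.mul_apply, LinearMap.toMatrix'_apply, rkOne, mul_comm]
  all_goals simp [hMat, XMat, Matrix.mul_apply, hX, mul_div_cancel_right₀ _ hm1]

end Invariant

section Total

set_option maxSynthPendingDepth 3

variable {m : ℕ} {V₁ V₂ : Type}
  [NormedAddCommGroup V₁] [NormedSpace ℝ V₁] [NormedAddCommGroup V₂] [NormedSpace ℝ V₂]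
  (σ₁ : GLm m →ₗ[ℝ] (V₁ →L[ℝ] V₁)) (σ₂ : GLm m →ₗ[ℝ] (V₂ →L[ℝ] V₂)) {K : ℕ}

variable (K) in
/-- `C0tot` as a linear map. -/
def C0totL {n : ℕ} (hs hs' : Fin n → Matrix (Idx m) (Idx m) ℝ) :
    SymbT m V₁ V₂ K →ₗ[ℝ] SymbT m V₁ V₂ K where
  toFun := C0tot m V₁ V₂ σ₁ σ₂ hs hs'
  map_add' S T := by
    funext k
    simp only [C0tot, C0op, ← sigmaL_apply, Pi.add_apply, map_add, smul_add,
      Finset.sum_add_distrib]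
    abel
  map_smul' c T := by
    funext k
    simp only [C0tot, C0op, ← sigmaL_apply, Pi.smul_apply, map_smul, Finset.smul_sum, smul_add,
      smul_comm c, RingHom.id_apply]

variable (K) in
/-- `gTot` as a linear map. -/
def gTotL (γf : ∀ k : ℕ, Dualm m → (Symb m V₁ V₂ (k+1) →ₗ[ℝ] Symb m V₁ V₂ k)) (h : Dualm m) :
    SymbT m V₁ V₂ K →ₗ[ℝ] SymbT m V₁ V₂ K where
  toFun := gTot m V₁ V₂ γf h
  map_add' S T := by
    funext k
    simp only [gTot, Pi.add_apply]
    split_ifs <;> simp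
  map_smul' c T := by
    funext k
    simp only [gTot, Pi.smul_apply, RingHom.id_apply]
    split_ifs <;> simp

variable {σ₁ σ₂} [FiniteDimensional ℝ V₁] [FiniteDimensional ℝ V₂]
  {γf : ∀ k : ℕ, Dualm m → (Symb m V₁ V₂ (k+1) →ₗ[ℝ] Symb m V₁ V₂ k)}

theorem gTot_comm (hσ₁ : IsLieRep m σ₁) (hγ : ∀ k, gammaProp m V₁ V₂ σ₁ (γf k)) (h h' : Dualm m)
    {T : SymbT m V₁ V₂ K} (hT : ∀ k : Fin (K + 1), T k ∈ spanGen m V₁ V₂ (k : ℕ)) :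
    gTot m V₁ V₂ γf h (gTot m V₁ V₂ γf h' T) = gTot m V₁ V₂ γf h' (gTot m V₁ V₂ γf h T) := by
  funext k
  simp only [gTot]
  split_ifs with h1 h2
  · exact gamma_comm hσ₁ (hγ _) (hγ _) h h' (hT ⟨k + 1 + 1, h2⟩)
  · simp
  · rfl

theorem gTot_C0tot (hσ₁ : IsLieRep m σ₁) (hγ : ∀ k, gammaProp m V₁ V₂ σ₁ (γf k)) (hm : m ≠ 0)
    {n : ℕ} {hs hs' : Fin n → Matrix (Idx m) (Idx m) ℝ} (hmem' : ∀ s, inS m (hs' s))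
    (hcompl : ∀ Y, inS m Y → (∑ s, kappa m Y (hs' s) • hs s) = Y) (h : Dualm m)
    {T : SymbT m V₁ V₂ K} (hT : ∀ k : Fin (K + 1), T k ∈ spanGen m V₁ V₂ (k : ℕ)) :
    gTot m V₁ V₂ γf h (C0tot m V₁ V₂ σ₁ σ₂ hs hs' T)
      = C0tot m V₁ V₂ σ₁ σ₂ hs hs' (gTot m V₁ V₂ γf h T)
        + (2 : ℝ) • ∑ i, gTot m V₁ V₂ γf (epsD m i) (sigmaT m V₁ V₂ σ₁ σ₂
          (rkOne m (Pi.single i 1) h + h (Pi.single i 1) • ContinuousLinearMap.id ℝ (Rm m)) T) := by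
  funext k
  simp only [gTot, C0tot, sigmaT, Pi.add_apply, Pi.smul_apply, Finset.sum_apply]
  split_ifs with h1
  · exact gamma_C0op hσ₁ (hγ _) hm hmem' hcompl h (hT ⟨k + 1, h1⟩)
  · simp [C0op, ← sigmaL_apply]

theorem commute_C0tot_Nom (hm : m ≠ 0) (hσ₁ : IsLieRep m σ₁)
    (hγ : ∀ k, gammaProp m V₁ V₂ σ₁ (γf k)) {n : ℕ} {hs hs' : Fin n → Matrix (Idx m) (Idx m) ℝ}
    (hmem' : ∀ s, inS m (hs' s))
    (hcompl : ∀ Y, inS m Y → (∑ s, kappa m Y (hs' s) • hs s) = Y)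
    {P : Type} [NormedAddCommGroup P] [NormedSpace ℝ P]
    {η : Matrix (Idx m) (Idx m) ℝ → P → P} (hη : ∀ Z, ContDiff ℝ (⊤ : ℕ∞) (η Z))
    (hbr : BracketCompat m P η) {f : P → SymbT m V₁ V₂ K} (hf : ContDiff ℝ (⊤ : ℕ∞) f)
    (hfval : ∀ u (k : Fin (K+1)), f u k ∈ spanGen m V₁ V₂ (k : ℕ))
    (hfeq : equivG0 m P η (fun B S => sigmaT m V₁ V₂ σ₁ σ₂ B S) f) (h : Dualm m) (u : P) :
    LD m P η (hMat m h)
          (fun w => C0tot m V₁ V₂ σ₁ σ₂ hs hs' (f w) + Nom m P V₁ V₂ γf η f w) u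
        + gTot m V₁ V₂ γf h (C0tot m V₁ V₂ σ₁ σ₂ hs hs' (f u) + Nom m P V₁ V₂ γf η f u)
      = C0tot m V₁ V₂ σ₁ σ₂ hs hs' (LD m P η (hMat m h) f u + gTot m V₁ V₂ γf h (f u))
          + Nom m P V₁ V₂ γf η
            (fun w => LD m P η (hMat m h) f w + gTot m V₁ V₂ γf h (f w)) u := by
  have hfd : Differentiable ℝ f := hf.differentiable (by simp)
  refine commute_of_bracket hη hf (C0totL σ₁ σ₂ K hs hs').toContinuousLinearMap
    (gTotL K γf h).toContinuousLinearMap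
    (fun i => (gTotL K γf (epsD m i)).toContinuousLinearMap) (hMat m h)
    (fun i => XMat m (Pi.single i 1))
    (fun i u => sigmaT m V₁ V₂ σ₁ σ₂
      (rkOne m (Pi.single i 1) h + h (Pi.single i 1) • ContinuousLinearMap.id ℝ (Rm m)) (f u))
    (fun i u => ?_) (fun i u => gTot_comm hσ₁ hγ _ _ fun k => ?_)
    (fun u => gTot_C0tot hσ₁ hγ hm hmem' hcompl h (hfval u)) u
  · have hb := congrFun (hbr _ f hf (hMat m h) (XMat m (Pi.single i 1))
      (by simp [Matrix.trace, hMat]) (by simp [Matrix.trace, XMat]) (fun _ => rfl)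
      ⟨fun _ _ => rfl, fun _ => rfl, rfl⟩) u
    rw [bracket_hMat_XMat, hfeq, Pi.sub_apply, sub_eq_iff_eq_add'] at hb
    rw [hb]
    congr 1
    funext k
    simp only [Pi.neg_apply, sigmaT, ← sigmaL_apply, map_neg, LinearMap.neg_apply, neg_neg]
  · have : LD m P η (XMat m (Pi.single i 1)) f u k
        = LD m P η (XMat m (Pi.single i 1)) (fun w => f w k) u :=
      (LD_clm (ContinuousLinearMap.proj k) _ (hfd u)).symm
    rw [this]
    exact LD_mem _ _ (differentiableAt_pi.1 (hfd u) k) (hfval · k)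

end Total

/-- for every `h ∈ 𝔤₁`, the operator `L_{ω^{-1}(h)} + γ(h)` commutes with
`C₀ + N^ω` on infinitesimally `G₀`-equivariant symbol-valued functions. -/
theorem statement18 (m K : ℕ) (hm : 2 ≤ m)
    (V₁ V₂ : Type) [NormedAddCommGroup V₁] [NormedSpace ℝ V₁] [FiniteDimensional ℝ V₁]
    [NormedAddCommGroup V₂] [NormedSpace ℝ V₂] [FiniteDimensional ℝ V₂]
    (σ₁ : GLm m →ₗ[ℝ] (V₁ →L[ℝ] V₁)) (hσ₁ : IsLieRep m σ₁)
    (σ₂ : GLm m →ₗ[ℝ] (V₂ →L[ℝ] V₂)) (hσ₂ : IsLieRep m σ₂)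
    (γf : ∀ k : ℕ, Dualm m → (Symb m V₁ V₂ (k+1) →ₗ[ℝ] Symb m V₁ V₂ k))
    (hγ : ∀ k : ℕ, gammaProp m V₁ V₂ σ₁ (γf k))
    (n : ℕ) (hs hs' : Fin n → Matrix (Idx m) (Idx m) ℝ)
    (hmem : ∀ s, inS m (hs s)) (hmem' : ∀ s, inS m (hs' s))
    (hdual : ∀ s t, kappa m (hs s) (hs' t) = if s = t then 1 else 0)
    (hcompl : ∀ Y, inS m Y → (∑ s, kappa m Y (hs' s) • hs s) = Y)
    (P : Type) [NormedAddCommGroup P] [NormedSpace ℝ P] [FiniteDimensional ℝ P]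
    (hdim : Module.finrank ℝ P = (m+1)^2 - 1)
    (η : Matrix (Idx m) (Idx m) ℝ → P → P)
    (hηsm : ∀ Z, ContDiff ℝ (⊤ : ℕ∞) (η Z))
    (hηadd : ∀ Z Z' u, η (Z + Z') u = η Z u + η Z' u)
    (hηsmul : ∀ (c : ℝ) Z u, η (c • Z) u = c • η Z u)
    (hbr : BracketCompat m P η)
    (f : P → SymbT m V₁ V₂ K) (hf : ContDiff ℝ (⊤ : ℕ∞) f)
    (hfval : ∀ u (k : Fin (K+1)), f u k ∈ spanGen m V₁ V₂ (k : ℕ))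
    (hfeq : equivG0 m P η (fun B S => sigmaT m V₁ V₂ σ₁ σ₂ B S) f)
    (h : Dualm m) :
    (fun u => LD m P η (hMat m h)
          (fun w => C0tot m V₁ V₂ σ₁ σ₂ hs hs' (f w) + Nom m P V₁ V₂ γf η f w) u
        + gTot m V₁ V₂ γf h (C0tot m V₁ V₂ σ₁ σ₂ hs hs' (f u) + Nom m P V₁ V₂ γf η f u))
      = (fun u => C0tot m V₁ V₂ σ₁ σ₂ hs hs'
            (LD m P η (hMat m h) f u + gTot m V₁ V₂ γf h (f u))
          + Nom m P V₁ V₂ γf η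
            (fun w => LD m P η (hMat m h) f w + gTot m V₁ V₂ γf h (f w)) u) := by
  exact funext fun u => commute_C0tot_Nom (by omega) hσ₁ hγ hmem' hcompl hηsm hbr hf hfval hfeq h u

end ProjQuant
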